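/- Let n ≥ 2, let w ∈ ℝ^n be a weight vector (w_i ≥ 0, Σ_i w_i = 1), and let ≽ be the preference relation on ℝ^n represented by OWA_w, i.e. f ≽ g ⟺ Σ_{i=1}^n w_i f_(i) ≥ Σ_{i=1}^n w_i g_(i). Then ≽ satisfies axiom A7 (order-preserving transfer) if and only if w_1 − w_2 = w_i − w_{i+1} for all i = 1,…,n−1. -/

import Mathlib

open Finset

/-- A capacity on `X = {1,…,n}` (modelled as `Fin n`). -/
def IsCapacity {n : ℕ} (μ : Finset (Fin n) → ℝ) : Prop :=
  μ ∅ = 0 ∧ μ Finset.univ = 1 ∧ ∀ A B : Finset (Fin n), A ⊆ B → μ A ≤ μ B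

/-- A symmetric capacity: the value depends only on the cardinality. -/
def IsSymmetricCap {n : ℕ} (μ : Finset (Fin n) → ℝ) : Prop :=
  ∀ A B : Finset (Fin n), A.card = B.card → μ A = μ B

/-- The Möbius transform of a set function. -/
noncomputable def mobius {n : ℕ} (μ : Finset (Fin n) → ℝ) (A : Finset (Fin n)) : ℝ :=
  ∑ B ∈ A.powerset, (-1 : ℝ) ^ (A.card - B.card) * μ B

/-- `μ` is at most `k`-additive: its Möbius transform vanishes on sets of more than `k` elements. -/
def AtMostAdditive {n : ℕ} (k : ℕ) (μ : Finset (Fin n) → ℝ) : Prop :=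
  ∀ A : Finset (Fin n), k < A.card → mobius μ A = 0

/-- The Choquet integral of the act `f` with respect to `μ`:
`C_μ(f) = Σ_i (f_(i) - f_(i-1)) μ(B_i)` with `f_(0) = 0`, where the increasing rearrangement
is obtained through the sorting permutation `Tuple.sort f`, and `B_i = {σ(i),…,σ(n)}`. -/
noncomputable def choquet {n : ℕ} (μ : Finset (Fin n) → ℝ) (f : Fin n → ℝ) : ℝ :=
  ∑ i : Fin n,
    (f (Tuple.sort f i) -
      if (i : ℕ) = 0 then 0
      else f (Tuple.sort f ⟨(i : ℕ) - 1, lt_of_le_of_lt (Nat.sub_le _ _) i.isLt⟩)) *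
    μ ((Finset.univ.filter fun j : Fin n => i ≤ j).image (Tuple.sort f))

/-- The OWA operator with weights `w`: `Σ_i w_i f_(i)`. -/
noncomputable def owa {n : ℕ} (w f : Fin n → ℝ) : ℝ :=
  ∑ i : Fin n, w i * f (Tuple.sort f i)

/-- `w` is the weight vector of the symmetric capacity `μ`:
`μ(T) = Σ_{i = n - |T| + 1}^{n} w_i` (1-based), i.e. the sum of the last `|T|` weights. -/
def IsWeightOf {n : ℕ} (w : Fin n → ℝ) (μ : Finset (Fin n) → ℝ) : Prop :=
  ∀ T : Finset (Fin n), T.Nonempty →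
    μ T = ∑ i ∈ Finset.univ.filter (fun i : Fin n => n - T.card ≤ (i : ℕ)), w i

/-- `w` viewed with natural-number (0-based) indices, junk value `0` out of range
(never used in the statements below). -/
noncomputable def wAt {n : ℕ} (w : Fin n → ℝ) (i : ℕ) : ℝ :=
  if h : i < n then w ⟨i, h⟩ else 0

/-- The alternating sum `Σ_{j=0}^{k-1} (-1)^j C(k-1,j) w_{i+j}`, with `i` a 1-based index. -/
noncomputable def altSum {n : ℕ} (w : Fin n → ℝ) (k i : ℕ) : ℝ :=
  ∑ j ∈ Finset.range k, (-1 : ℝ) ^ j * ((k - 1).choose j : ℝ) * wAt w (i - 1 + j)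

/-- A preference relation on acts. -/
abbrev Pref (n : ℕ) := (Fin n → ℝ) → (Fin n → ℝ) → Prop

/-- Asymmetric (strict) part of a preference relation. -/
def StrictP {n : ℕ} (R : Pref n) (f g : Fin n → ℝ) : Prop := R f g ∧ ¬ R g f

/-- Symmetric (indifference) part of a preference relation. -/
def IndiffP {n : ℕ} (R : Pref n) (f g : Fin n → ℝ) : Prop := R f g ∧ R g f

/-- `V` represents `≽`: `f ≽ g ↔ V f ≥ V g`. -/
def Represents {n : ℕ} (V : (Fin n → ℝ) → ℝ) (R : Pref n) : Prop :=
  ∀ f g, R f g ↔ V g ≤ V f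

/-- A1: weak order (complete, reflexive, transitive). -/
def AxA1 {n : ℕ} (R : Pref n) : Prop :=
  (∀ f g, R f g ∨ R g f) ∧ (∀ f, R f f) ∧ (∀ f g h, R f g → R g h → R f h)

/-- A2: continuity, the strict upper and lower contour sets are open. -/
def AxA2 {n : ℕ} (R : Pref n) : Prop :=
  ∀ f, IsOpen {g | StrictP R g f} ∧ IsOpen {g | StrictP R f g}

/-- A3: symmetry under permutations. -/
def AxA3 {n : ℕ} (R : Pref n) : Prop :=
  ∀ (f : Fin n → ℝ) (π : Equiv.Perm (Fin n)), IndiffP R f (f ∘ π)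

/-- A4: weak independence of income source (on nondecreasing acts). -/
def AxA4 {n : ℕ} (R : Pref n) : Prop :=
  ∀ f g h : Fin n → ℝ, Monotone f → Monotone g → Monotone h →
    (R f g ↔ R (f + h) (g + h))

/-- A5: monotonicity. -/
def AxA5 {n : ℕ} (R : Pref n) : Prop :=
  ∀ f g : Fin n → ℝ, (∀ i, g i ≤ f i) → R f g

/-- A6: non-triviality. -/
def AxA6 {n : ℕ} (R : Pref n) : Prop :=
  ∃ f g, StrictP R f g

/-- `i` `f`-precedes `j` : `f i < f j` and no value of `f` lies strictly between them. -/
def Precedes {n : ℕ} (f : Fin n → ℝ) (i j : Fin n) : Prop :=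
  f i < f j ∧ ∀ l, ¬ (f i < f l ∧ f l < f j)

/-- A7: order-preserving transfer. -/
def AxA7 {n : ℕ} (R : Pref n) : Prop :=
  ∀ (f f' g g' : Fin n → ℝ) (i j : Fin n) (t : ℝ), 0 < t →
    Precedes f i j → Precedes g i j → Precedes f' i j → Precedes g' i j →
    f' i = f i + t → g' i = g i + t → f' j = f j - t → g' j = g j - t →
    (∀ l, l ≠ i → l ≠ j → f' l = f l) → (∀ l, l ≠ i → l ≠ j → g' l = g l) →
    (R f g ↔ R f' g')

/-- A8: inequality aversion. -/
def AxA8 {n : ℕ} (R : Pref n) : Prop :=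
  ∀ (f f' : Fin n → ℝ), Monotone f → Monotone f' →
    ∀ (i : Fin n) (hi : (i : ℕ) + 1 < n) (t : ℝ), 0 < t →
      f' i = f i + t → f' ⟨(i : ℕ) + 1, hi⟩ = f ⟨(i : ℕ) + 1, hi⟩ - t →
      (∀ j, j ≠ i → j ≠ (⟨(i : ℕ) + 1, hi⟩ : Fin n) → f' j = f j) →
      StrictP R f' f

/-- Comonotone acts. -/
def Comonotone {n : ℕ} (f g : Fin n → ℝ) : Prop :=
  ∀ i j, 0 ≤ (f i - f j) * (g i - g j)

/-- The chain condition: (0-based) index `i` `f`-precedes `i+1`, which `f`-precedes `i+2`, …,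
which `f`-precedes `i+k`. -/
def PrecChain {n : ℕ} (f : Fin n → ℝ) (i k : ℕ) (h : i + k < n) : Prop :=
  ∀ r, ∀ _hr : r < k, Precedes f ⟨i + r, by omega⟩ ⟨i + r + 1, by omega⟩

/-- A7(k): k-dimensional order-preserving transfer. -/
def AxA7k {n : ℕ} (k : ℕ) (R : Pref n) : Prop :=
  ∀ (f g f' g' : Fin n → ℝ) (i : ℕ) (hik : i + k < n) (t : ℝ), 0 < t →
    PrecChain f i k hik → PrecChain g i k hik →
    PrecChain f' i k hik → PrecChain g' i k hik →
    (∀ j, ∀ _hj : j < k, f' ⟨i + j, by omega⟩ =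
      f ⟨i + j, by omega⟩ + (-1 : ℝ) ^ j * ((k - 1).choose j : ℝ) * t) →
    (∀ j, ∀ _hj : j < k, g' ⟨i + j, by omega⟩ =
      g ⟨i + j, by omega⟩ + (-1 : ℝ) ^ j * ((k - 1).choose j : ℝ) * t) →
    (∀ l : Fin n, ((l : ℕ) < i ∨ i + k ≤ (l : ℕ)) → f' l = f l) →
    (∀ l : Fin n, ((l : ℕ) < i ∨ i + k ≤ (l : ℕ)) → g' l = g l) →
    Comonotone f f' → Comonotone g g' →
    (R f g ↔ R f' g')

/-- The act `f^B`: add `t` to the coordinates in `B`, keep the others. -/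
def shiftAct {n : ℕ} (f : Fin n → ℝ) (t : ℝ) (B : Finset (Fin n)) : Fin n → ℝ :=
  fun l => if l ∈ B then f l + t else f l

/-- A9: asymmetric order-preserving transfer (2-dimensional). -/
def AxA9 {n : ℕ} (R : Pref n) : Prop :=
  ∃ H : (Fin n → ℝ) → ℝ, Represents H R ∧
    ∀ i j : Fin n, i ≠ j → ∀ f g : Fin n → ℝ, f i = f j → g i = g j →
      ∀ t : ℝ, 0 < t →
      (∀ B ∈ ({i, j} : Finset (Fin n)).powerset, Comonotone f (shiftAct f t B)) →
      (∀ B ∈ ({i, j} : Finset (Fin n)).powerset, Comonotone g (shiftAct g t B)) →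
      ∑ B ∈ ({i, j} : Finset (Fin n)).powerset, (-1 : ℝ) ^ B.card * H (shiftAct f t B) =
        ∑ B ∈ ({i, j} : Finset (Fin n)).powerset, (-1 : ℝ) ^ B.card * H (shiftAct g t B)

/-- A9(k): k-dimensional asymmetric order-preserving transfer. -/
def AxA9k {n : ℕ} (k : ℕ) (R : Pref n) : Prop :=
  ∃ H : (Fin n → ℝ) → ℝ, Represents H R ∧
    ∀ S : Finset (Fin n), S.card = k →
      ∀ f g : Fin n → ℝ, (∀ i ∈ S, ∀ j ∈ S, f i = f j) → (∀ i ∈ S, ∀ j ∈ S, g i = g j) →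
        ∀ t : ℝ, 0 < t →
        (∀ B ∈ S.powerset, Comonotone f (shiftAct f t B)) →
        (∀ B ∈ S.powerset, Comonotone g (shiftAct g t B)) →
        ∑ B ∈ S.powerset, (-1 : ℝ) ^ B.card * H (shiftAct f t B) =
          ∑ B ∈ S.powerset, (-1 : ℝ) ^ B.card * H (shiftAct g t B)

theorem owa_eq_of_monotone {n : ℕ} (w f : Fin n → ℝ) (σ : Equiv.Perm (Fin n))
    (h : Monotone (f ∘ σ)) : owa w f = ∑ l, w l * f (σ l) := by
  have e := Tuple.comp_sort_eq_comp_iff_monotone.2 h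
  exact Finset.sum_congr rfl fun l _ => congrArg (w l * ·) (congrFun e l).symm

theorem owa_add_const {n : ℕ} (w f : Fin n → ℝ) (hw : ∑ i, w i = 1) (c : ℝ) :
    owa w (fun l => f l + c) = owa w f + c := by
  have h : Monotone ((fun l => f l + c) ∘ Tuple.sort f) := (Tuple.monotone_sort f).add_const c
  rw [owa_eq_of_monotone w _ _ h]
  simp only [mul_add, Finset.sum_add_distrib, ← Finset.sum_mul, hw, one_mul, owa]

theorem Precedes.add_const {n : ℕ} {f : Fin n → ℝ} {i j : Fin n} (h : Precedes f i j) (c : ℝ) :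
    Precedes (fun l => f l + c) i j :=
  ⟨by simpa using h.1, fun l hl => h.2 l (by simpa using hl)⟩

/-- Transferring `t` from `j` to `i`, where `i` precedes `j` before and after the transfer, changes
`OWA_w` by `t` times the difference of two consecutive weights, at the position given by the number
of coordinates not exceeding `f i`. -/
theorem owa_transfer {n : ℕ} (w : Fin n → ℝ) {f f' : Fin n → ℝ} {i j : Fin n} {t : ℝ}
    (ht : 0 < t) (hf : Precedes f i j) (hf' : Precedes f' i j)
    (hi : f' i = f i + t) (hj : f' j = f j - t) (ho : ∀ l, l ≠ i → l ≠ j → f' l = f l) :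
    ∃ p : ℕ, p + 1 < n ∧ #{l | f l ≤ f i} = p + 1 ∧
      owa w f' = owa w f + t * (wAt w p - wAt w (p + 1)) := by
  obtain ⟨hlt, hno⟩ := hf
  obtain ⟨hlt', hno'⟩ := hf'
  have hij : i ≠ j := fun h => hlt.ne (congrArg f h)
  have cases (l : Fin n) : l = i ∨ l = j ∨ (f' l = f l ∧ f l ≤ f i) ∨ (f' l = f l ∧ f j ≤ f l) := by
    by_cases h1 : l = i
    · exact .inl h1
    by_cases h2 : l = j
    · exact .inr (.inl h2)
    have := ho l h1 h2
    rcases le_or_gt (f l) (f i) with h | h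
    · exact .inr (.inr (.inl ⟨this, h⟩))
    · exact .inr (.inr (.inr ⟨this, not_lt.1 fun h' => hno l ⟨h, h'⟩⟩))
  have eq_i (l : Fin n) (h : f' l = f' i) : l = i := by
    rcases cases l with rfl | rfl | ⟨h1, h2⟩ | ⟨h1, h2⟩
    · rfl
    all_goals linarith
  have eq_j (l : Fin n) (h : f' l = f' j) : l = j := by
    rcases cases l with rfl | rfl | ⟨h1, h2⟩ | ⟨h1, h2⟩
    · linarith
    · rfl
    all_goals linarith
  have le_i (l : Fin n) : f l ≤ f i ↔ f' l ≤ f' i := by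
    rcases cases l with rfl | rfl | ⟨h1, h2⟩ | ⟨h1, h2⟩ <;>
      constructor <;> intro h <;> linarith
  have mono (l m : Fin n) (h : f' l ≤ f' m) : f l ≤ f m := by
    rcases cases l with rfl | rfl | ⟨h1, h2⟩ | ⟨h1, h2⟩ <;>
      rcases cases m with rfl | rfl | ⟨h3, h4⟩ | ⟨h3, h4⟩ <;> linarith
  set σ := Tuple.sort f' with hσ
  have hm : Monotone (f' ∘ σ) := Tuple.monotone_sort f'
  obtain ⟨p, rfl⟩ := σ.surjective i
  obtain ⟨q, rfl⟩ := σ.surjective j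
  have hpq : p < q := lt_of_not_ge fun h => hlt'.not_ge (hm h)
  have hadj : (q : ℕ) = p + 1 := by
    by_contra hne
    have hr : (p : ℕ) + 1 < n := by omega
    have h1 : p < ⟨p + 1, hr⟩ := Fin.lt_def.2 (by simp)
    have h2 : ⟨p + 1, hr⟩ < q := Fin.lt_def.2 (by simp; omega)
    exact hno' (σ ⟨p + 1, hr⟩)
      ⟨lt_of_le_of_ne (hm h1.le) fun h => h1.ne' (σ.injective (eq_i _ h.symm)),
        lt_of_le_of_ne (hm h2.le) fun h => h2.ne (σ.injective (eq_j _ h))⟩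
  refine ⟨p, by omega, ?_, ?_⟩
  · have : ({l | f l ≤ f (σ p)} : Finset (Fin n)) = (Iic p).map σ.toEmbedding := by
      ext l
      obtain ⟨m, rfl⟩ := σ.surjective l
      simp only [mem_filter, mem_univ, true_and, le_i]
      simp only [mem_map_equiv, Equiv.symm_apply_apply, mem_Iic]
      refine ⟨fun h => ?_, fun h => hm h⟩
      by_contra hlt
      exact hlt (σ.injective (eq_i _ (le_antisymm h (hm (not_le.1 hlt).le)))).le
    rw [this, card_map, Fin.card_Iic]
  · have hwp : wAt w p = w p := by simp [wAt]
    have hwq : wAt w (p + 1) = w q := by simp [wAt, ← hadj]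
    rw [owa_eq_of_monotone w f' σ hm, owa_eq_of_monotone w f σ fun a b hab => mono _ _ (hm hab),
      ← sub_eq_iff_eq_add', ← Finset.sum_sub_distrib, hwp, hwq,
      Fintype.sum_eq_add p q hpq.ne]
    · rw [hi, hj]; ring
    · rintro l ⟨h1, h2⟩
      rw [ho _ (σ.injective.ne h1) (σ.injective.ne h2), sub_self]

/-- An act with value `a` at `0`, value `b` at `1`, `-1` at the next `k` indices and `4` at the
remaining ones. -/
def stepAct (n k : ℕ) (a b : ℝ) (l : Fin n) : ℝ :=
  if (l : ℕ) = 0 then a else if (l : ℕ) = 1 then b else if (l : ℕ) < k + 2 then -1 else 4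

theorem precedes_stepAct {n : ℕ} (k : ℕ) {a b : ℝ} (ha : -1 ≤ a) (hab : a < b) (hb : b ≤ 4)
    (h0 : 0 < n) (h1 : 1 < n) : Precedes (stepAct n k a b) ⟨0, h0⟩ ⟨1, h1⟩ := by
  refine ⟨by simpa [stepAct] using hab, fun l hl => ?_⟩
  simp only [stepAct, one_ne_zero, if_true, if_false] at hl
  split_ifs at hl <;> linarith [hl.1, hl.2]

theorem card_stepAct_le {n k : ℕ} (hk : k + 1 < n) (h0 : 0 < n) :
    #{l | stepAct n k 0 3 l ≤ stepAct n k 0 3 ⟨0, h0⟩} = k + 1 := by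
  have : ({l | stepAct n k 0 3 l ≤ stepAct n k 0 3 ⟨0, h0⟩} : Finset (Fin n)) =
      (Iic ⟨k + 1, hk⟩).erase ⟨1, by omega⟩ := by
    ext l
    simp only [stepAct, mem_filter, mem_univ, true_and, if_true, mem_erase, mem_Iic, ne_eq,
      Fin.ext_iff, Fin.le_def]
    split_ifs <;> norm_num <;> omega
  rw [this, card_erase_of_mem (by simp [Fin.le_def]), Fin.card_Iic]
  simp

/-- for a preference represented by `OWA_w`, A7 is equivalent to equidistance of
the weights. -/
theorem stmt_5 (n : ℕ) (hn : 2 ≤ n) (w : Fin n → ℝ) (hw0 : ∀ i, 0 ≤ w i)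
    (hw1 : ∑ i, w i = 1) (R : Pref n) (hR : Represents (owa w) R) :
    AxA7 R ↔ (∀ i : ℕ, i + 1 < n → wAt w 0 - wAt w 1 = wAt w i - wAt w (i + 1)) := by
  constructor
  · intro hA k hk
    have h0 : 0 < n := by omega
    have h1 : 1 < n := by omega
    have pre (m : ℕ) := precedes_stepAct (n := n) m (a := 0) (b := 3) (by norm_num) (by norm_num)
      (by norm_num) h0 h1
    have pre' (m : ℕ) := precedes_stepAct (n := n) m (a := 1) (b := 2) (by norm_num) (by norm_num)
      (by norm_num) h0 h1
    have at_i (m : ℕ) : stepAct n m 1 2 ⟨0, h0⟩ = stepAct n m 0 3 ⟨0, h0⟩ + 1 := by simp [stepAct]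
    have at_j (m : ℕ) : stepAct n m 1 2 ⟨1, h1⟩ = stepAct n m 0 3 ⟨1, h1⟩ - 1 := by
      norm_num [stepAct]
    have off (m : ℕ) (l : Fin n) (hl0 : l ≠ ⟨0, h0⟩) (hl1 : l ≠ ⟨1, h1⟩) :
        stepAct n m 1 2 l = stepAct n m 0 3 l := by
      simp only [ne_eq, Fin.ext_iff] at hl0 hl1
      simp [stepAct, hl0, hl1]
    have diff (m : ℕ) (hm : m + 1 < n) : owa w (stepAct n m 1 2) =
        owa w (stepAct n m 0 3) + (wAt w m - wAt w (m + 1)) := by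
      obtain ⟨p, -, hp, h⟩ :=
        owa_transfer w one_pos (pre m) (pre' m) (at_i m) (at_j m) (off m)
      rw [card_stepAct_le hm] at hp
      obtain rfl : m = p := by omega
      rwa [one_mul] at h
    set c := owa w (stepAct n 0 0 3) - owa w (stepAct n k 0 3) with hc
    have d0 := diff 0 h1
    have dk := diff k hk
    have eg := owa_add_const w (stepAct n k 0 3) hw1 c
    have eg' := owa_add_const w (stepAct n k 1 2) hw1 c
    have fg := (hA _ _ _ _ _ _ 1 one_pos (pre 0) ((pre k).add_const c) (pre' 0)
      ((pre' k).add_const c) (at_i 0) (by rw [at_i]; ring) (at_j 0) (by rw [at_j]; ring) (off 0)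
      fun l hl0 hl1 => by rw [off k l hl0 hl1]).1 ((hR _ _).2 (by linarith))
    have gf := (hA _ _ _ _ _ _ 1 one_pos ((pre k).add_const c) (pre 0) ((pre' k).add_const c)
      (pre' 0) (by rw [at_i]; ring) (at_i 0) (by rw [at_j]; ring) (at_j 0)
      (fun l hl0 hl1 => by rw [off k l hl0 hl1]) (off 0)).1 ((hR _ _).2 (by linarith))
    rw [hR] at fg gf
    rw [zero_add] at d0
    linarith
  · intro hd f f' g g' i j t ht hf hg hf' hg' hfi hgi hfj hgj hfo hgo
    obtain ⟨p, hp, -, ef⟩ := owa_transfer w ht hf hf' hfi hfj hfo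
    obtain ⟨q, hq, -, eg⟩ := owa_transfer w ht hg hg' hgi hgj hgo
    rw [hR, hR, ef, eg, ← hd p hp, ← hd q hq, add_le_add_iff_right]
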